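/- arXiv:1903.01658 — 3 statements merged into one kernel-verified Lean document; each statement's English description precedes it below -/
import Mathlib

section
/- Let p1, p2, α1, α2 ∈ [0,1] and β1, β2 ≥ 0 with βi² ≤ αi(1−αi) for i = 1, 2, and define the product states ρ1 = [[1−p1,0],[0,p1]] ⊗ [[1−p2,0],[0,p2]] and ρ2 = [[1−α1, β1],[β1, α1]] ⊗ [[1−α2, β2],[β2, α2]] on ℂ² ⊗ ℂ². If ρ1 and ρ2 are perfectly distinguishable in SEP, then Re Tr(ρ1 ρ2) ≤ β1 β2 |(2p1−1)(2p2−1)| ≤ β1 β2 ≤ 1/4. -/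
open Matrix Kronecker ComplexOrder

noncomputable section

abbrev Mat (dA dB : ℕ) := Matrix (Fin dA × Fin dB) (Fin dA × Fin dB) ℂ

/-- Membership in the dual cone SEP*. -/
def InSEPDual {dA dB : ℕ} (M : Mat dA dB) : Prop :=
  M.IsHermitian ∧ ∀ (A : Matrix (Fin dA) (Fin dA) ℂ) (B : Matrix (Fin dB) (Fin dB) ℂ),
    A.PosSemidef → B.PosSemidef → 0 ≤ ((A ⊗ₖ B) * M).trace

/-- Perfect distinguishability of two states in SEP. -/
def PerfDistSEP {dA dB : ℕ} (ρ1 ρ2 : Mat dA dB) : Prop :=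
  ∃ M1 M2 : Mat dA dB, InSEPDual M1 ∧ InSEPDual M2 ∧ M1 + M2 = 1 ∧
    (M1 * ρ1).trace = 1 ∧ (M2 * ρ2).trace = 1 ∧ (M2 * ρ1).trace = 0 ∧ (M1 * ρ2).trace = 0

/-- Real symmetric 2x2 matrix. -/
def RS (a b c : ℝ) : Matrix (Fin 2) (Fin 2) ℂ := !![(a : ℂ), (b : ℂ); (b : ℂ), (c : ℂ)]

lemma quad_nonneg {a b c : ℝ} (ha : 0 ≤ a) (hc : 0 ≤ c) (hb : b ^ 2 ≤ a * c) (x y : ℝ) :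
    0 ≤ a * x ^ 2 + 2 * b * x * y + c * y ^ 2 := by
  rcases ha.eq_or_lt with h | h
  · subst h
    have : b = 0 := by nlinarith [sq_nonneg b]
    subst this
    nlinarith [mul_nonneg hc (sq_nonneg y)]
  · have h1 : 0 ≤ a * (a * x ^ 2 + 2 * b * x * y + c * y ^ 2) := by
      nlinarith [sq_nonneg (a * x + b * y), mul_nonneg (sub_nonneg.2 hb) (sq_nonneg y)]
    exact nonneg_of_mul_nonneg_right h1 h

lemma RS_psd {a b c : ℝ} (ha : 0 ≤ a) (hc : 0 ≤ c) (hb : b ^ 2 ≤ a * c) :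
    (RS a b c).PosSemidef := by
  refine Matrix.PosSemidef.of_dotProduct_mulVec_nonneg ?_ ?_
  · ext i j
    fin_cases i <;> fin_cases j <;> simp [RS]
  · intro x
    have h1 := quad_nonneg ha hc hb (x 0).re (x 1).re
    have h2 := quad_nonneg ha hc hb (x 0).im (x 1).im
    rw [Complex.le_def]
    constructor
    · simp [RS, Matrix.mulVec, dotProduct, Fin.sum_univ_two]
      nlinarith
    · simp [RS, Matrix.mulVec, dotProduct, Fin.sum_univ_two]
      ring

/-- The bilinear functional. -/
def FF (M : Mat 2 2) (a b c d e k : ℝ) : ℝ := (((RS a b c) ⊗ₖ (RS d e k)) * M).trace.re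

lemma FF_lin (M : Mat 2 2) (a b c d e k : ℝ) :
    FF M a b c d e k = a * FF M 1 0 0 d e k + b * FF M 0 1 0 d e k + c * FF M 0 0 1 d e k := by
  simp [FF, RS, Matrix.trace, Matrix.mul_apply, Fintype.sum_prod_type, Fin.sum_univ_two,
    Matrix.kroneckerMap_apply]
  ring

lemma FF_lin2 (M : Mat 2 2) (a b c d e k : ℝ) :
    FF M a b c d e k = d * FF M a b c 1 0 0 + e * FF M a b c 0 1 0 + k * FF M a b c 0 0 1 := by
  simp [FF, RS, Matrix.trace, Matrix.mul_apply, Fintype.sum_prod_type, Fin.sum_univ_two,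
    Matrix.kroneckerMap_apply]
  ring

lemma FF_one (a b c d e k : ℝ) : FF 1 a b c d e k = (a + c) * (d + k) := by
  simp [FF, RS, Matrix.trace, Fintype.sum_prod_type, Fin.sum_univ_two,
    Matrix.kroneckerMap_apply]
  ring

/-- A linear functional between zero and the trace on real PSD matrices. -/
def Eff (r1 r2 r3 : ℝ) : Prop := ∀ a b c : ℝ, 0 ≤ a → 0 ≤ c → b ^ 2 ≤ a * c →
  0 ≤ a * r1 + b * r2 + c * r3 ∧ a * r1 + b * r2 + c * r3 ≤ a + c

lemma disc_of_nonneg {r1 r2 r3 : ℝ} (h1 : 0 ≤ r1) (h3 : 0 ≤ r3)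
    (h : ∀ x y : ℝ, 0 ≤ x ^ 2 * r1 + x * y * r2 + y ^ 2 * r3) : r2 ^ 2 ≤ 4 * r1 * r3 := by
  have := discrim_le_zero (a := r1) (b := r2) (c := r3) (fun x => by
    have := h x 1
    nlinarith)
  unfold discrim at this
  linarith

lemma Eff.facts {r1 r2 r3 : ℝ} (h : Eff r1 r2 r3) : 0 ≤ r1 ∧ r1 ≤ 1 ∧ 0 ≤ r3 ∧ r3 ≤ 1 ∧
    r2 ^ 2 ≤ 4 * r1 * r3 ∧ r2 ^ 2 ≤ 4 * (1 - r1) * (1 - r3) := by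
  obtain ⟨h1, h1'⟩ := h 1 0 0 (by norm_num) (by norm_num) (by norm_num)
  obtain ⟨h3, h3'⟩ := h 0 0 1 (by norm_num) (by norm_num) (by norm_num)
  norm_num at h1 h1' h3 h3'
  have hx := fun x y : ℝ => h (x ^ 2) (x * y) (y ^ 2) (sq_nonneg _) (sq_nonneg _)
    (le_of_eq (by ring))
  refine ⟨h1, h1', h3, h3', disc_of_nonneg h1 h3 fun x y => (hx x y).1, ?_⟩
  have := disc_of_nonneg (r1 := 1 - r1) (r2 := -r2) (r3 := 1 - r3) (by linarith) (by linarith)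
    fun x y => by nlinarith [(hx x y).2]
  nlinarith

lemma L1 {r1 r2 r3 p α β : ℝ} (h : Eff r1 r2 r3) (hp : p ∈ Set.Icc (0 : ℝ) 1)
    (hα : α ∈ Set.Icc (0 : ℝ) 1) (hs : (1 - p) * r1 + 0 * r2 + p * r3 = 1) :
    ((p ≠ 0 ∧ p ≠ 1) → (1 - α) * r1 + β * r2 + α * r3 = 1) ∧
    ((p = 0 ∨ p = 1) → (1 - p) * (1 - α) + p * α ≤ (1 - α) * r1 + β * r2 + α * r3) := by
  obtain ⟨h1, h1', h3, h3', hd, hd'⟩ := h.facts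
  obtain ⟨hp0, hp1⟩ := hp
  obtain ⟨ha0, ha1⟩ := hα
  constructor
  · rintro ⟨hp0', hp1'⟩
    have hp0 : 0 < p := lt_of_le_of_ne hp0 (Ne.symm hp0')
    have hp1 : p < 1 := lt_of_le_of_ne hp1 hp1'
    have e1 : r1 = 1 := by nlinarith
    have e3 : r3 = 1 := by nlinarith
    subst e1 e3
    have : r2 = 0 := by nlinarith
    subst this
    ring
  · rintro (rfl | rfl)
    · have e1 : r1 = 1 := by linarith
      subst e1
      have : r2 = 0 := by nlinarith
      subst this
      nlinarith
    · have e1 : r3 = 1 := by linarith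
      subst e1
      have : r2 = 0 := by nlinarith
      subst this
      nlinarith

lemma L2 {r1 r2 r3 p α β : ℝ} (h : Eff r1 r2 r3) (hp : p ∈ Set.Icc (0 : ℝ) 1)
    (hα : α ∈ Set.Icc (0 : ℝ) 1) (hβ : β ^ 2 ≤ α * (1 - α))
    (hs : (1 - α) * r1 + β * r2 + α * r3 = 0) :
    (1 - p) * r1 + 0 * r2 + p * r3 ≤ 1 - ((1 - p) * (1 - α) + p * α) ∧
    (β ^ 2 < α * (1 - α) → (1 - p) * r1 + 0 * r2 + p * r3 = 0) := by
  obtain ⟨h1, h1', h3, h3', hd, hd'⟩ := h.facts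
  obtain ⟨hp0, hp1⟩ := hp
  obtain ⟨ha0, ha1⟩ := hα
  have hn := (h α (-β) (1 - α) ha0 (by linarith) (by nlinarith)).2
  have hsum : r1 + r3 ≤ 1 := by nlinarith
  have hsq : ((1 - α) * r1 + α * r3) ^ 2 = β ^ 2 * r2 ^ 2 := by
    have : (1 - α) * r1 + α * r3 = - (β * r2) := by linarith
    rw [this]; ring
  have hb4 : β ^ 2 * r2 ^ 2 ≤ β ^ 2 * (4 * r1 * r3) :=
    mul_le_mul_of_nonneg_left hd (sq_nonneg β)
  have h13 : 0 ≤ r1 * r3 := mul_nonneg h1 h3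
  have hk := mul_nonneg h13 (sub_nonneg.2 hβ)
  have hz : (1 - α) * r1 - α * r3 = 0 := by
    have : ((1 - α) * r1 - α * r3) ^ 2 ≤ 0 := by nlinarith
    exact pow_eq_zero_iff (two_ne_zero) |>.1 (le_antisymm this (sq_nonneg _))
  have e1 : r1 ≤ α := by nlinarith
  have e3 : r3 ≤ 1 - α := by nlinarith
  refine ⟨by nlinarith, fun hlt => ?_⟩
  have hsqz := sq_nonneg ((1 - α) * r1 - α * r3)
  have h0 : r1 * r3 = 0 := by
    have : r1 * r3 * (α * (1 - α) - β ^ 2) ≤ 0 := by nlinarith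
    by_contra hne
    have := mul_pos (lt_of_le_of_ne h13 (Ne.symm hne)) (sub_pos.2 hlt)
    linarith
  have hpos : 0 < α * (1 - α) := lt_of_le_of_lt (sq_nonneg β) hlt
  have a0 : α ≠ 0 := by rintro rfl; simp at hpos
  have a1 : 1 - α ≠ 0 := by intro h; rw [h] at hpos; simp at hpos
  rcases mul_eq_zero.1 h0 with h0 | h0
  · have : r3 = 0 := by
      rw [h0] at hz
      have : α * r3 = 0 := by linarith
      exact (mul_eq_zero.1 this).resolve_left a0
    rw [h0, this]; ring
  · have : r1 = 0 := by
      rw [h0] at hz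
      have : (1 - α) * r1 = 0 := by linarith
      exact (mul_eq_zero.1 this).resolve_left a1
    rw [h0, this]; ring

lemma FF_bounds {M1 M2 : Mat 2 2} (h1 : InSEPDual M1) (h2 : InSEPDual M2) (hs : M1 + M2 = 1)
    {a b c d e k : ℝ} (ha : 0 ≤ a) (hc : 0 ≤ c) (hb : b ^ 2 ≤ a * c)
    (hd : 0 ≤ d) (hk : 0 ≤ k) (he : e ^ 2 ≤ d * k) :
    0 ≤ FF M1 a b c d e k ∧ FF M1 a b c d e k ≤ (a + c) * (d + k) := by
  have e1 : 0 ≤ FF M1 a b c d e k :=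
    (Complex.le_def.1 (h1.2 _ _ (RS_psd ha hc hb) (RS_psd hd hk he))).1
  have e2 : 0 ≤ FF M2 a b c d e k :=
    (Complex.le_def.1 (h2.2 _ _ (RS_psd ha hc hb) (RS_psd hd hk he))).1
  have e3 : FF M1 a b c d e k + FF M2 a b c d e k = FF 1 a b c d e k := by
    rw [← hs]; simp [FF, Matrix.mul_add, Matrix.trace_add]
  rw [FF_one] at e3
  exact ⟨e1, by linarith⟩

set_option maxHeartbeats 1000000 in
lemma core {M1 M2 : Mat 2 2} (h1 : InSEPDual M1) (h2 : InSEPDual M2) (hs : M1 + M2 = 1)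
    (p1 p2 α1 α2 β1 β2 : ℝ)
    (hp1 : p1 ∈ Set.Icc (0:ℝ) 1) (hp2 : p2 ∈ Set.Icc (0:ℝ) 1)
    (hα1 : α1 ∈ Set.Icc (0:ℝ) 1) (hα2 : α2 ∈ Set.Icc (0:ℝ) 1)
    (hβ1 : 0 ≤ β1) (hβ2 : 0 ≤ β2)
    (hβ1' : β1 ^ 2 ≤ α1 * (1 - α1)) (hβ2' : β2 ^ 2 ≤ α2 * (1 - α2))
    (hA : FF M1 (1 - p1) 0 p1 (1 - p2) 0 p2 = 1)
    (hB : FF M1 (1 - α1) β1 α1 (1 - α2) β2 α2 = 0) :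
    ((1 - p1) * (1 - α1) + p1 * α1) * ((1 - p2) * (1 - α2) + p2 * α2) ≤
      β1 * β2 * |(2 * p1 - 1) * (2 * p2 - 1)| := by
  have effA : ∀ d e k : ℝ, 0 ≤ d → 0 ≤ k → e ^ 2 ≤ d * k → d + k = 1 →
      Eff (FF M1 1 0 0 d e k) (FF M1 0 1 0 d e k) (FF M1 0 0 1 d e k) := by
    intro d e k hd hk he h a b c ha hc hb
    have := FF_bounds h1 h2 hs ha hc hb hd hk he
    rwa [h, mul_one, FF_lin] at this
  have effB : ∀ a b c : ℝ, 0 ≤ a → 0 ≤ c → b ^ 2 ≤ a * c → a + c = 1 →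
      Eff (FF M1 a b c 1 0 0) (FF M1 a b c 0 1 0) (FF M1 a b c 0 0 1) := by
    intro a b c ha hc hb h d e k hd hk he
    have := FF_bounds h1 h2 hs ha hc hb hd hk he
    rwa [h, one_mul, FF_lin2] at this
  have q1 : 0 ≤ 1 - p1 := by linarith [hp1.2]
  have q2 : 0 ≤ 1 - p2 := by linarith [hp2.2]
  have a1 : 0 ≤ 1 - α1 := by linarith [hα1.2]
  have a2 : 0 ≤ 1 - α2 := by linarith [hα2.2]
  have z1 : (0 : ℝ) ^ 2 ≤ (1 - p1) * p1 := by nlinarith [mul_nonneg q1 hp1.1]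
  have z2 : (0 : ℝ) ^ 2 ≤ (1 - p2) * p2 := by nlinarith [mul_nonneg q2 hp2.1]
  have v1 := L1 (β := β1) (effA (1 - p2) 0 p2 q2 hp2.1 z2 (by ring)) hp1 hα1
    (by rw [← FF_lin]; exact hA)
  have v2 := L2 (effB (1 - α1) β1 α1 a1 hα1.1 (by linarith) (by ring)) hp2 hα2 hβ2'
    (by rw [← FF_lin2]; exact hB)
  have w1 := L1 (β := β2) (effB (1 - p1) 0 p1 q1 hp1.1 z1 (by ring)) hp2 hα2
    (by rw [← FF_lin2]; exact hA)
  have w2 := L2 (effA (1 - α2) β2 α2 a2 hα2.1 (by linarith) (by ring)) hp1 hα1 hβ1'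
    (by rw [← FF_lin]; exact hB)
  rw [← FF_lin] at v1 w2
  rw [← FF_lin2] at v2 w1
  generalize FF M1 (1 - α1) β1 α1 (1 - p2) 0 p2 = v at v1 v2
  generalize FF M1 (1 - p1) 0 p1 (1 - α2) β2 α2 = w at w1 w2
  clear effA effB hA hB h1 h2 hs
  have hD1 : 0 ≤ (1 - p1) * (1 - α1) + p1 * α1 :=
    add_nonneg (mul_nonneg q1 a1) (mul_nonneg hp1.1 hα1.1)
  have hD2 : 0 ≤ (1 - p2) * (1 - α2) + p2 * α2 :=
    add_nonneg (mul_nonneg q2 a2) (mul_nonneg hp2.1 hα2.1)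
  have hR : 0 ≤ β1 * β2 * |(2 * p1 - 1) * (2 * p2 - 1)| := by positivity
  have done1 : (1 - p1) * (1 - α1) + p1 * α1 ≤ 0 →
      ((1 - p1) * (1 - α1) + p1 * α1) * ((1 - p2) * (1 - α2) + p2 * α2) ≤
      β1 * β2 * |(2 * p1 - 1) * (2 * p2 - 1)| := by
    intro h; rw [le_antisymm h hD1, zero_mul]; exact hR
  have done2 : (1 - p2) * (1 - α2) + p2 * α2 ≤ 0 →
      ((1 - p1) * (1 - α1) + p1 * α1) * ((1 - p2) * (1 - α2) + p2 * α2) ≤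
      β1 * β2 * |(2 * p1 - 1) * (2 * p2 - 1)| := by
    intro h; rw [le_antisymm h hD2, mul_zero]; exact hR
  by_cases c1 : p1 ≠ 0 ∧ p1 ≠ 1
  · exact done2 (by linarith [v1.1 c1, v2.1])
  by_cases c2 : p2 ≠ 0 ∧ p2 ≠ 1
  · exact done1 (by linarith [w1.1 c2, w2.1])
  have c1' : p1 = 0 ∨ p1 = 1 := by tauto
  have c2' : p2 = 0 ∨ p2 = 1 := by tauto
  have V1 := v1.2 c1'
  have W1 := w1.2 c2'
  rcases hβ2'.lt_or_eq with b2 | b2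
  · exact done1 (by linarith [v2.2 b2])
  rcases hβ1'.lt_or_eq with b1 | b1
  · exact done2 (by linarith [w2.2 b1])
  have hsum := V1.trans v2.1
  have habs : |(2 * p1 - 1) * (2 * p2 - 1)| = 1 := by
    rcases c1' with rfl | rfl <;> rcases c2' with rfl | rfl <;> norm_num
  rw [habs, mul_one]
  have E1 : β1 ^ 2 = ((1 - p1) * (1 - α1) + p1 * α1) * (1 - ((1 - p1) * (1 - α1) + p1 * α1)) := by
    rw [b1]; rcases c1' with rfl | rfl <;> ring
  have E2 : β2 ^ 2 = ((1 - p2) * (1 - α2) + p2 * α2) * (1 - ((1 - p2) * (1 - α2) + p2 * α2)) := by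
    rw [b2]; rcases c2' with rfl | rfl <;> ring
  generalize (1 - p1) * (1 - α1) + p1 * α1 = D1 at *
  generalize (1 - p2) * (1 - α2) + p2 * α2 = D2 at *
  refine abs_le_of_sq_le_sq' ?_ (mul_nonneg hβ1 hβ2) |>.2
  rw [mul_pow β1, E1, E2]
  nlinarith [mul_nonneg (mul_nonneg hD1 hD2) (sub_nonneg.2 hsum)]

/-- Necessity for product (possibly mixed) states: perfect distinguishability implies
`Re Tr(ρ1 ρ2) ≤ β1 β2 |(2p1−1)(2p2−1)| ≤ β1 β2 ≤ 1/4`. -/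
theorem necessity_mixed (p1 p2 α1 α2 β1 β2 : ℝ)
    (hp1 : p1 ∈ Set.Icc (0:ℝ) 1) (hp2 : p2 ∈ Set.Icc (0:ℝ) 1)
    (hα1 : α1 ∈ Set.Icc (0:ℝ) 1) (hα2 : α2 ∈ Set.Icc (0:ℝ) 1)
    (hβ1 : 0 ≤ β1) (hβ2 : 0 ≤ β2)
    (hβ1' : β1 ^ 2 ≤ α1 * (1 - α1)) (hβ2' : β2 ^ 2 ≤ α2 * (1 - α2))
    (h : PerfDistSEP
      ((!![((1 - p1 : ℝ) : ℂ), 0; 0, (p1 : ℝ)]) ⊗ₖ (!![((1 - p2 : ℝ) : ℂ), 0; 0, (p2 : ℝ)]))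
      ((!![((1 - α1 : ℝ) : ℂ), (β1 : ℝ); (β1 : ℝ), (α1 : ℝ)]) ⊗ₖ
        (!![((1 - α2 : ℝ) : ℂ), (β2 : ℝ); (β2 : ℝ), (α2 : ℝ)]))) :
    (((!![((1 - p1 : ℝ) : ℂ), 0; 0, (p1 : ℝ)]) ⊗ₖ (!![((1 - p2 : ℝ) : ℂ), 0; 0, (p2 : ℝ)]) *
        ((!![((1 - α1 : ℝ) : ℂ), (β1 : ℝ); (β1 : ℝ), (α1 : ℝ)]) ⊗ₖ
          (!![((1 - α2 : ℝ) : ℂ), (β2 : ℝ); (β2 : ℝ), (α2 : ℝ)]))).trace).re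
        ≤ β1 * β2 * |(2 * p1 - 1) * (2 * p2 - 1)| ∧
      β1 * β2 * |(2 * p1 - 1) * (2 * p2 - 1)| ≤ β1 * β2 ∧
      β1 * β2 ≤ 1 / 4 := by
  obtain ⟨M1, M2, h1, h2, hs, hA, -, -, hB⟩ := h
  have hA' : FF M1 (1 - p1) 0 p1 (1 - p2) 0 p2 = 1 := by
    rw [Matrix.trace_mul_comm] at hA
    unfold FF RS
    rw [Complex.ofReal_zero, hA, Complex.one_re]
  have hB' : FF M1 (1 - α1) β1 α1 (1 - α2) β2 α2 = 0 := by
    rw [Matrix.trace_mul_comm] at hB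
    unfold FF RS
    rw [hB, Complex.zero_re]
  have hc := core h1 h2 hs p1 p2 α1 α2 β1 β2 hp1 hp2 hα1 hα2 hβ1 hβ2 hβ1' hβ2' hA' hB'
  refine ⟨?_, ?_, ?_⟩
  · rw [← Matrix.mul_kronecker_mul, Matrix.trace_kronecker]
    refine le_trans (le_of_eq ?_) hc
    simp [Matrix.trace, Matrix.mul_apply, Fin.sum_univ_two]
  · refine mul_le_of_le_one_right (mul_nonneg hβ1 hβ2) ?_
    rw [abs_mul]
    refine mul_le_one₀ ?_ (abs_nonneg _) ?_ <;> rw [abs_le] <;>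
      constructor <;> linarith [hp1.1, hp1.2, hp2.1, hp2.2]
  · have b1 : β1 ≤ 1 / 2 := by nlinarith [sq_nonneg (α1 - 1 / 2)]
    have b2 : β2 ≤ 1 / 2 := by nlinarith [sq_nonneg (α2 - 1 / 2)]
    nlinarith
end
end

section
/- Let dA = dB = 2. A Hermitian matrix Y on ℂ² ⊗ ℂ² lies in the dual cone SEP* if and only if there exist positive semidefinite 4×4 matrices T and T' such that Y = T + Γ(T'). -/
open Matrix Kronecker ComplexOrder

noncomputable section

/-- Partial transpose on the second factor. -/
def ptB {dA dB : ℕ} (X : Mat dA dB) : Mat dA dB :=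
  Matrix.of fun p q => X (p.1, q.2) (q.1, p.2)

/-! ### Quadratic polynomials -/

/-- A quadratic polynomial bounded below has a stationary point. -/
lemma exists_stationary {E : Type*} [NormedAddCommGroup E] [InnerProductSpace ℝ E]
    [FiniteDimensional ℝ E] (T : E →ₗ[ℝ] E) (hT : T.IsSymmetric) (l : E) (e : ℝ)
    (h : ∀ v, 0 ≤ inner ℝ (T v) v + 2 * inner ℝ l v + e) : ∃ v, T v = -l := by
  have hl : l ∈ T.rangeᗮᗮ := by
    rw [hT.orthogonal_range, Submodule.mem_orthogonal]
    intro k hk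
    have hk0 : T k = 0 := hk
    by_contra hne
    have h1 := h ((-(e + 1) / (2 * inner ℝ l k)) • k)
    have hne' : inner ℝ l k ≠ 0 := by rwa [real_inner_comm]
    rw [map_smul, hk0, smul_zero, inner_zero_left, inner_smul_right] at h1
    have : 2 * (-(e + 1) / (2 * inner ℝ l k) * inner ℝ l k) = -(e+1) := by
      field_simp
    linarith
  rw [Submodule.orthogonal_orthogonal] at hl
  obtain ⟨v, hv⟩ := hl
  exact ⟨-v, by rw [map_neg, hv]⟩

lemma exists_stationary_complex (a c e : ℝ) (u w b d : ℂ)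
    (h : ∀ x y : ℂ, 0 ≤ a * Complex.normSq x + c * Complex.normSq y
      + 2 * (star u * (x * y)).re + 2 * (w * (star x * y)).re
      + 2 * (star b * x).re + 2 * (star d * y).re + e) :
    ∃ x y : ℂ, a * x + u * star y + w * y + b = 0 ∧ c * y + u * star x + star w * x + d = 0 := by
  let M : Matrix (Fin 4) (Fin 4) ℝ :=
    !![a, 0, u.re + w.re, u.im - w.im;
       0, a, u.im + w.im, w.re - u.re;
       u.re + w.re, u.im + w.im, c, 0;
       u.im - w.im, w.re - u.re, 0, c]
  have hM : M.IsHermitian := by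
    ext i j; fin_cases i <;> fin_cases j <;> simp [M]
  obtain ⟨v, hv⟩ := exists_stationary (Matrix.toEuclideanLin M)
    (Matrix.isSymmetric_toEuclideanLin_iff.2 hM) (!₂[b.re, b.im, d.re, d.im]) e (by
      intro v
      have := h ⟨v 0, v 1⟩ ⟨v 2, v 3⟩
      simp [Complex.normSq_apply] at this
      simp [PiLp.inner_apply, Fin.sum_univ_four, Matrix.toLpLin_apply, M,
        dotProduct]
      linarith)
  refine ⟨⟨v 0, v 1⟩, ⟨v 2, v 3⟩, ?_, ?_⟩
  · have h0 := congrArg (fun t => t 0) hv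
    have h1 := congrArg (fun t => t 1) hv
    simp [Fin.sum_univ_four, Matrix.toLpLin_apply, M, dotProduct] at h0 h1
    apply Complex.ext <;> simp <;> linarith
  · have h0 := congrArg (fun t => t 2) hv
    have h1 := congrArg (fun t => t 3) hv
    simp [Fin.sum_univ_four, Matrix.toLpLin_apply, M, dotProduct] at h0 h1
    apply Complex.ext <;> simp <;> linarith

lemma eq_zero_of_linear_term (a : ℝ) (w : ℂ)
    (h : ∀ z : ℂ, 0 ≤ a * Complex.normSq z + 2 * (w * z).re) : w = 0 := by
  by_contra hw
  have hp : 0 < Complex.normSq w := Complex.normSq_pos.2 hw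
  have ht : (0:ℝ) < |a| + 1 := by positivity
  have h1 := h ((-(1 / (|a| + 1)) : ℝ) * star w)
  have e1 : (w * ((-(1 / (|a| + 1)) : ℝ) * star w)).re = -(1 / (|a| + 1)) * Complex.normSq w := by
    simp [Complex.normSq_apply]; ring
  have e2 : Complex.normSq ((-(1 / (|a| + 1)) : ℝ) * star w)
      = (1 / (|a| + 1)) * (1 / (|a| + 1)) * Complex.normSq w := by
    rw [Complex.normSq_mul, Complex.normSq_ofReal]
    have : Complex.normSq (star w) = Complex.normSq w := Complex.normSq_conj w
    rw [this]; ring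
  rw [e1, e2] at h1
  set s := 1 / (|a| + 1) with hs
  have hs0 : 0 < s := by positivity
  have hsa : a * s < 1 := by
    rw [hs, mul_one_div, div_lt_one ht]; linarith [le_abs_self a]
  have : a * (s * s * Complex.normSq w) + 2 * (-s * Complex.normSq w)
      = (s * Complex.normSq w) * (a * s - 2) := by ring
  rw [this] at h1
  have : 0 < s * Complex.normSq w := by positivity
  nlinarith

/-- Simultaneous choice of phases. -/
lemma exists_phases (u w : ℂ) : ∃ x y : ℂ, Complex.normSq x = 1 ∧ Complex.normSq y = 1 ∧
    star u * (x * y) = -(‖u‖ : ℂ) ∧ w * (star x * y) = -(‖w‖ : ℂ) := by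
  have key : ∀ z : ℂ, ∃ p : ℂ, star p * p = 1 ∧ z * p = -(‖z‖ : ℂ) := by
    intro z
    by_cases hz : z = 0
    · exact ⟨1, by simp, by simp [hz]⟩
    · have hn : (‖z‖ : ℂ) ≠ 0 := by simpa using hz
      have hzz : star z * z = (‖z‖ : ℂ) ^ 2 := Complex.conj_mul' z
      refine ⟨-(star z / ‖z‖), ?_, ?_⟩
      · have : star (-(star z / (‖z‖ : ℂ))) = -(z / ‖z‖) := by simp
        rw [this]; field_simp; rw [← hzz]; ring
      · field_simp; rw [← hzz]; ring
  obtain ⟨p, hp, hup⟩ := key (star u)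
  obtain ⟨q, hq, hwq⟩ := key w
  obtain ⟨x, hx'⟩ := IsAlgClosed.exists_pow_nat_eq (p * star q) (n := 2) (by norm_num)
  have hx := hx'.symm
  have hx1 : star x * x = 1 := by
    have h2 : (Complex.normSq x) ^ 2 = 1 := by
      rw [← map_pow, ← hx, map_mul]
      have h3 : Complex.normSq p = 1 := by
        have := Complex.normSq_eq_conj_mul_self (z := p)
        exact_mod_cast this.trans hp
      have h4 : Complex.normSq (star q) = 1 := by
        have := Complex.normSq_eq_conj_mul_self (z := q)
        exact (Complex.normSq_conj q).trans (by exact_mod_cast this.trans hq)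
      rw [h3, h4, one_mul]
    have h5 : Complex.normSq x = 1 := by
      nlinarith [Complex.normSq_nonneg x]
    have := Complex.normSq_eq_conj_mul_self (z := x)
    rw [h5] at this
    exact_mod_cast this.symm
  have toN : ∀ z : ℂ, star z * z = 1 → Complex.normSq z = 1 := by
    intro z hz
    have := Complex.normSq_eq_conj_mul_self (z := z)
    exact_mod_cast this.trans hz
  refine ⟨x, q * x, toN _ hx1, ?_, ?_, ?_⟩
  · rw [map_mul, toN _ hx1, toN _ hq, one_mul]
  · have : x * (q * x) = p := by
      calc x * (q * x) = q * x ^ 2 := by ring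
        _ = p * (star q * q) := by rw [← hx]; ring
        _ = p := by rw [hq, mul_one]
    rw [this, hup, norm_star]
  · have : star x * (q * x) = q := by
      calc star x * (q * x) = q * (star x * x) := by ring
        _ = q := by rw [hx1, mul_one]
    rw [this, hwq]

lemma norm_bound (a c : ℝ) (u w : ℂ)
    (h : ∀ x y : ℂ, 0 ≤ a * Complex.normSq x + c * Complex.normSq y
      + 2 * (star u * (x * y)).re + 2 * (w * (star x * y)).re) :
    0 ≤ a ∧ 0 ≤ c ∧ (‖u‖ + ‖w‖) ^ 2 ≤ a * c := by
  have ha : 0 ≤ a := by simpa using h 1 0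
  have hc : 0 ≤ c := by simpa using h 0 1
  refine ⟨ha, hc, ?_⟩
  obtain ⟨x, y, hx, hy, h1, h2⟩ := exists_phases u w
  have hh : ∀ X Z : ℝ, 0 ≤ a * X ^ 2 + c * Z ^ 2 - 2 * (‖u‖ + ‖w‖) * (X * Z) := by
    intro X Z
    have := h (X * x) (Z * y)
    have e1 : star u * ((X * x) * (Z * y)) = ((-(X * Z * ‖u‖) : ℝ) : ℂ) := by
      push_cast
      linear_combination (X * Z : ℂ) * h1
    have e2 : w * (star (X * x) * (Z * y)) = ((-(X * Z * ‖w‖) : ℝ) : ℂ) := by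
      have : star ((X:ℂ) * x) = X * star x := by simp
      rw [this]
      push_cast
      linear_combination (X * Z : ℂ) * h2
    rw [e1, e2, map_mul, map_mul, hx, hy, Complex.normSq_ofReal, Complex.normSq_ofReal,
      Complex.ofReal_re, Complex.ofReal_re] at this
    nlinarith
  have hd := discrim_le_zero (a := a) (b := -2 * (‖u‖ + ‖w‖)) (c := c) (by
    intro X; have := hh X 1; nlinarith)
  unfold discrim at hd
  nlinarith

lemma exists_split (a c m n : ℝ) (ha : 0 ≤ a) (hc : 0 ≤ c) (hm : 0 ≤ m) (hn : 0 ≤ n)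
    (h : (m + n) ^ 2 ≤ a * c) : ∃ a1 c1 a2 c2 : ℝ, 0 ≤ a1 ∧ 0 ≤ c1 ∧ 0 ≤ a2 ∧ 0 ≤ c2 ∧
      a1 + a2 = a ∧ c1 + c2 = c ∧ n ^ 2 ≤ a1 * c1 ∧ m ^ 2 ≤ a2 * c2 := by
  rcases (add_nonneg hm hn).eq_or_lt with h0 | h0
  · have hm0 : m = 0 := by linarith
    have hn0 : n = 0 := by linarith
    exact ⟨a, c, 0, 0, ha, hc, le_rfl, le_rfl, by simp, by simp,
      by rw [hn0]; simpa using mul_nonneg ha hc, by simp [hm0]⟩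
  · have e : ∀ t : ℝ, t ^ 2 ≤ a * (t / (m + n)) * (c * (t / (m + n))) := by
      intro t
      have h1 : a * (t / (m + n)) * (c * (t / (m + n))) = (a * c) * (t / (m + n)) ^ 2 := by ring
      have h2 : t ^ 2 = (m + n) ^ 2 * (t / (m + n)) ^ 2 := by field_simp
      rw [h1]
      calc t ^ 2 = (m + n) ^ 2 * (t / (m + n)) ^ 2 := h2
        _ ≤ _ := by gcongr
    refine ⟨a * (n / (m + n)), c * (n / (m + n)), a * (m / (m + n)), c * (m / (m + n)),
      by positivity, by positivity, by positivity, by positivity, ?_, ?_, e n, e m⟩ <;>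
    · field_simp; ring

/-! ### Block positivity and decomposability -/

/-- product vector -/
def pv (x y : Fin 2 → ℂ) : Fin 2 × Fin 2 → ℂ := fun p => x p.1 * y p.2

/-- the biquadratic form of a matrix -/
def bq (Y : Mat 2 2) (x y : Fin 2 → ℂ) : ℂ := star (pv x y) ⬝ᵥ (Y *ᵥ pv x y)

def Decomp (Y : Mat 2 2) : Prop :=
  ∃ T T' : Mat 2 2, T.PosSemidef ∧ T'.PosSemidef ∧ Y = T + ptB T'

lemma bq_nonneg {Y : Mat 2 2} (h : InSEPDual Y) (x y : Fin 2 → ℂ) : 0 ≤ bq Y x y := by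
  have := h.2 _ _ (posSemidef_vecMulVec_self_star x) (posSemidef_vecMulVec_self_star y)
  convert this using 1
  simp [bq, pv, Matrix.trace, Matrix.mul_apply, dotProduct, Matrix.mulVec, vecMulVec_apply,
    Fintype.sum_prod_type, Fin.sum_univ_two]
  ring

lemma ptB_conj (P R : Matrix (Fin 2) (Fin 2) ℂ) (X : Mat 2 2) :
    (P ⊗ₖ R)ᴴ * ptB X * (P ⊗ₖ R)
      = ptB ((P ⊗ₖ R.map star)ᴴ * X * (P ⊗ₖ R.map star)) := by
  ext ⟨i, j⟩ ⟨k, l⟩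
  simp [ptB, Matrix.mul_apply, Fintype.sum_prod_type, Fin.sum_univ_two]
  ring

lemma Decomp.conj {Y : Mat 2 2} (h : Decomp Y) (P R : Matrix (Fin 2) (Fin 2) ℂ) :
    Decomp ((P ⊗ₖ R)ᴴ * Y * (P ⊗ₖ R)) := by
  obtain ⟨T, T', hT, hT', rfl⟩ := h
  refine ⟨_, _, hT.conjTranspose_mul_mul_same (P ⊗ₖ R),
    hT'.conjTranspose_mul_mul_same (P ⊗ₖ R.map star), ?_⟩
  rw [Matrix.mul_add, Matrix.add_mul, ptB_conj]

lemma bq_conj (Y : Mat 2 2) (P R : Matrix (Fin 2) (Fin 2) ℂ) (x y : Fin 2 → ℂ) :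
    bq ((P ⊗ₖ R)ᴴ * Y * (P ⊗ₖ R)) x y = bq Y (P *ᵥ x) (R *ᵥ y) := by
  have : (P ⊗ₖ R) *ᵥ pv x y = pv (P *ᵥ x) (R *ᵥ y) := by
    ext ⟨i, j⟩
    simp [pv, Matrix.mulVec, dotProduct, Fintype.sum_prod_type, Fin.sum_univ_two]
    ring
  rw [bq, bq, ← this, star_mulVec, ← Matrix.mulVec_mulVec, ← Matrix.mulVec_mulVec,
    Matrix.dotProduct_mulVec _ (P ⊗ₖ R)ᴴ]

/-- index of a pair -/
def ix (p : Fin 2 × Fin 2) : Fin 4 := ![![0, 1], ![2, 3]] p.1 p.2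

/-- canonical matrix -/
def canon (u w : ℂ) (a c e : ℝ) : Mat 2 2 := Matrix.of fun p q =>
  !![0, 0, 0, u; 0, (a : ℂ), w, 0; 0, star w, (c : ℂ), 0; star u, 0, 0, (e : ℂ)]
    (ix p) (ix q)

lemma canon_posSemidef (w : ℂ) (a c e : ℝ) (ha : 0 ≤ a) (hc : 0 ≤ c) (he : 0 ≤ e)
    (h : ‖w‖ ^ 2 ≤ a * c) : (canon 0 w a c e).PosSemidef := by
  apply Matrix.PosSemidef.of_dotProduct_mulVec_nonneg
  · ext ⟨i, j⟩ ⟨k, l⟩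
    fin_cases i <;> fin_cases j <;> fin_cases k <;> fin_cases l <;>
      simp [canon, ix]
  · intro v
    have e1 : star v ⬝ᵥ (canon 0 w a c e *ᵥ v) =
        ((a * Complex.normSq (v (0, 1)) + c * Complex.normSq (v (1, 0))
          + 2 * (w * (star (v (0, 1)) * v (1, 0))).re + e * Complex.normSq (v (1, 1)) : ℝ) : ℂ) := by
      simp [canon, dotProduct, Matrix.mulVec, Fintype.sum_prod_type, Fin.sum_univ_two,
        ix]
      apply Complex.ext <;> simp [Complex.normSq_apply] <;> ring
    rw [e1, Complex.zero_le_real]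
    have h1 : |(w * (star (v (0, 1)) * v (1, 0))).re| ≤ ‖w‖ * (‖v (0, 1)‖ * ‖v (1, 0)‖) := by
      refine (Complex.abs_re_le_norm _).trans ?_
      simp
    rw [Complex.normSq_eq_norm_sq, Complex.normSq_eq_norm_sq, Complex.normSq_eq_norm_sq]
    have h2 := (abs_le.1 h1).1
    set p := ‖v (0, 1)‖
    set q := ‖v (1, 0)‖
    have hp : 0 ≤ p := norm_nonneg _
    have hq : 0 ≤ q := norm_nonneg _
    have h3 : ‖w‖ ≤ √a * √c := by
      rw [← Real.sqrt_mul ha]; exact Real.le_sqrt_of_sq_le h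
    have h4 : ‖w‖ * (p * q) ≤ √a * √c * (p * q) := by gcongr
    have h5 : a * p ^ 2 + c * q ^ 2 - 2 * (√a * √c * (p * q)) = (√a * p - √c * q) ^ 2 := by
      linear_combination (-p ^ 2) * Real.sq_sqrt ha - q ^ 2 * Real.sq_sqrt hc
    have h6 : 0 ≤ e * ‖v (1, 1)‖ ^ 2 := by positivity
    nlinarith [sq_nonneg (√a * p - √c * q)]

lemma canon_decomp (u w : ℂ) (a c e : ℝ) (ha : 0 ≤ a) (hc : 0 ≤ c) (he : 0 ≤ e)
    (h : (‖u‖ + ‖w‖) ^ 2 ≤ a * c) : Decomp (canon u w a c e) := by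
  obtain ⟨a1, c1, a2, c2, ha1, hc1, ha2, hc2, h1, h2, h3, h4⟩ :=
    exists_split a c ‖u‖ ‖w‖ ha hc (norm_nonneg _) (norm_nonneg _) h
  refine ⟨_, _, canon_posSemidef w a1 c1 e ha1 hc1 he h3,
    canon_posSemidef u a2 c2 0 ha2 hc2 le_rfl h4, ?_⟩
  ext ⟨i, j⟩ ⟨k, l⟩
  fin_cases i <;> fin_cases j <;> fin_cases k <;> fin_cases l <;>
      simp [canon, ptB, ix, ← h1, ← h2]

lemma bq_expand (Y : Mat 2 2) (hY : Y.IsHermitian) (x0 x1 y0 y1 : ℂ) :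
    (bq Y ![x0, x1] ![y0, y1]).re =
      (Y (0,0) (0,0)).re * Complex.normSq (x0 * y0) + (Y (0,1) (0,1)).re * Complex.normSq (x0 * y1)
      + (Y (1,0) (1,0)).re * Complex.normSq (x1 * y0)
      + (Y (1,1) (1,1)).re * Complex.normSq (x1 * y1)
      + 2 * (Y (0,0) (0,1) * (star (x0 * y0) * (x0 * y1))).re
      + 2 * (Y (0,0) (1,0) * (star (x0 * y0) * (x1 * y0))).re
      + 2 * (Y (0,0) (1,1) * (star (x0 * y0) * (x1 * y1))).re
      + 2 * (Y (0,1) (1,0) * (star (x0 * y1) * (x1 * y0))).re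
      + 2 * (Y (0,1) (1,1) * (star (x0 * y1) * (x1 * y1))).re
      + 2 * (Y (1,0) (1,1) * (star (x1 * y0) * (x1 * y1))).re := by
  have hh : ∀ p q, Y p q = star (Y q p) := fun p q => (hY.apply p q).symm
  have hd : ∀ p, (Y p p).im = 0 := by
    intro p
    have := congrArg Complex.im (hh p p)
    simp at this; linarith
  have e1 : bq Y ![x0, x1] ![y0, y1] = 
      star (x0 * y0) * (Y (0,0) (0,0) * (x0 * y0) + Y (0,0) (0,1) * (x0 * y1)
        + Y (0,0) (1,0) * (x1 * y0) + Y (0,0) (1,1) * (x1 * y1))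
      + star (x0 * y1) * (star (Y (0,0) (0,1)) * (x0 * y0) + Y (0,1) (0,1) * (x0 * y1)
        + Y (0,1) (1,0) * (x1 * y0) + Y (0,1) (1,1) * (x1 * y1))
      + star (x1 * y0) * (star (Y (0,0) (1,0)) * (x0 * y0) + star (Y (0,1) (1,0)) * (x0 * y1)
        + Y (1,0) (1,0) * (x1 * y0) + Y (1,0) (1,1) * (x1 * y1))
      + star (x1 * y1) * (star (Y (0,0) (1,1)) * (x0 * y0) + star (Y (0,1) (1,1)) * (x0 * y1)
        + star (Y (1,0) (1,1)) * (x1 * y0) + Y (1,1) (1,1) * (x1 * y1)) := by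
    rw [← hh, ← hh, ← hh, ← hh, ← hh, ← hh]
    simp [bq, pv, dotProduct, Matrix.mulVec, Fintype.sum_prod_type, Fin.sum_univ_two]
    ring
  rw [e1]
  generalize x0 * y0 = v0
  generalize x0 * y1 = v1
  generalize x1 * y0 = v2
  generalize x1 * y1 = v3
  simp [Complex.normSq_apply, hd]
  ring

lemma shear_eq (Y : Mat 2 2) (u w σ τ : ℂ) (a c e' : ℝ)
    (h00 : Y (0,0) (0,0) = 0) (h01 : Y (0,0) (0,1) = 0) (h02 : Y (0,0) (1,0) = 0)
    (h03 : Y (0,0) (1,1) = u)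
    (h10 : Y (0,1) (0,0) = 0) (h11 : Y (0,1) (0,1) = a) (h12 : Y (0,1) (1,0) = w)
    (h13 : Y (0,1) (1,1) = -(a * σ + u * star τ + w * τ))
    (h20 : Y (1,0) (0,0) = 0) (h21 : Y (1,0) (0,1) = star w) (h22 : Y (1,0) (1,0) = c)
    (h23 : Y (1,0) (1,1) = -(c * τ + u * star σ + star w * σ))
    (h30 : Y (1,1) (0,0) = star u)
    (h31 : Y (1,1) (0,1) = star (-(a * σ + u * star τ + w * τ)))
    (h32 : Y (1,1) (1,0) = star (-(c * τ + u * star σ + star w * σ)))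
    (h33 : Y (1,1) (1,1) = e' + a * (star σ * σ) + c * (star τ * τ)
      + star u * (σ * τ) + u * star (σ * τ) + w * (star σ * τ) + star w * (σ * star τ)) :
    Y = (!![1, -σ; 0, 1] ⊗ₖ !![1, -τ; 0, 1])ᴴ * canon u w a c e'
      * (!![1, -σ; 0, 1] ⊗ₖ !![1, -τ; 0, 1]) := by
  ext ⟨i, j⟩ ⟨k, l⟩
  fin_cases i <;> fin_cases j <;> fin_cases k <;> fin_cases l <;>
      simp [canon, Matrix.mul_apply, Fintype.sum_prod_type, Fin.sum_univ_two, ix,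
        h00, h01, h02, h03, h10, h11, h12, h13, h20, h21, h22, h23, h30, h31, h32, h33] <;> ring

lemma core_s4 (Y : Mat 2 2) (hY : Y.IsHermitian) (h : ∀ x y, 0 ≤ (bq Y x y).re)
    (h0 : Y (0,0) (0,0) = 0) : Decomp Y := by
  have hh : ∀ p q, Y p q = star (Y q p) := fun p q => (hY.apply p q).symm
  have hd : ∀ p, ((Y p p).re : ℂ) = Y p p := by
    intro p
    have := congrArg Complex.im (hh p p)
    simp at this
    apply Complex.ext <;> simp; linarith
  have h1 : Y (0,0) (0,1) = 0 := by
    apply eq_zero_of_linear_term (Y (0,1) (0,1)).re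
    intro z
    have := h ![1, 0] ![1, z]
    rw [bq_expand Y hY] at this
    simpa [h0] using this
  have h2 : Y (0,0) (1,0) = 0 := by
    apply eq_zero_of_linear_term (Y (1,0) (1,0)).re
    intro z
    have := h ![1, z] ![1, 0]
    rw [bq_expand Y hY] at this
    simpa [h0] using this
  set u := Y (0,0) (1,1) with hu
  set w := Y (0,1) (1,0) with hw
  set b := Y (0,1) (1,1) with hb
  set d := Y (1,0) (1,1) with hd'
  set a := (Y (0,1) (0,1)).re with ha
  set c := (Y (1,0) (1,0)).re with hc
  set e := (Y (1,1) (1,1)).re with he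
  have hQ : ∀ x r y s : ℂ, 0 ≤ a * Complex.normSq (x * s) + c * Complex.normSq (r * y)
      + e * Complex.normSq (r * s)
      + 2 * (u * (star (x * y) * (r * s))).re + 2 * (w * (star (x * s) * (r * y))).re
      + 2 * (b * (star (x * s) * (r * s))).re + 2 * (d * (star (r * y) * (r * s))).re := by
    intro x r y s
    have := h ![x, r] ![y, s]
    rw [bq_expand Y hY, h0, h1, h2] at this
    simp only [Complex.zero_re, zero_mul, mul_zero, zero_add, add_zero] at this
    linarith
  have hQ1 : ∀ x y : ℂ, 0 ≤ a * Complex.normSq x + c * Complex.normSq y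
      + 2 * (star u * (x * y)).re + 2 * (w * (star x * y)).re
      + 2 * (star b * x).re + 2 * (star d * y).re + e := by
    intro x y
    have := hQ x 1 y 1
    simp at this ⊢
    linarith
  obtain ⟨σ, τ, hs, ht⟩ := exists_stationary_complex a c e u w b d hQ1
  obtain ⟨ha0, hc0, hac⟩ := norm_bound a c u w (by
    intro x y
    by_contra hneg
    push Not at hneg
    -- scale by a large real factor
    set q := a * Complex.normSq x + c * Complex.normSq y
      + 2 * (star u * (x * y)).re + 2 * (w * (star x * y)).re with hq
    set l := 2 * (star b * x).re + 2 * (star d * y).re with hl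
    have hX : ∀ X : ℝ, 0 ≤ q * (X * X) + l * X + e := by
      intro X
      have := hQ1 (X * x) (X * y)
      convert this using 1
      rw [hq, hl]
      simp [Complex.normSq_apply]
      ring
    have hp := hX 0
    have h3 := hX ((|l| + e + 1) / (-q) + 1)
    set X := (|l| + e + 1) / (-q) + 1 with hXd
    have hXq : (-q) * (X - 1) = |l| + e + 1 := by
      rw [hXd, add_sub_cancel_right, mul_div_cancel₀]
      exact (by linarith : (0:ℝ) < -q).ne'
    have : 0 ≤ (|l| + e + 1) / (-q) := by
      apply div_nonneg _ (by linarith)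
      have := abs_nonneg l
      linarith
    have hX1 : 1 ≤ X := by linarith
    have h5 : l * X ≤ |l| * X := by
      gcongr; exact le_abs_self l
    have h6 : (-q) * X = |l| + e + 1 - q := by linarith
    have h7 : q * (X * X) = -(|l| + e + 1 - q) * X := by rw [← h6]; ring
    nlinarith)
  set e' := e + (star b * σ).re + (star d * τ).re with he'
  have hbσ : (star b * σ).re = -(a * Complex.normSq σ + (star u * (σ * τ)).re
      + (w * (star σ * τ)).re) := by
    have : b = -(a * σ + u * star τ + w * τ) := by linear_combination hs
    rw [this]; simp [Complex.normSq_apply]; ring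
  have hdτ : (star d * τ).re = -(c * Complex.normSq τ + (star u * (σ * τ)).re
      + (w * (star σ * τ)).re) := by
    have : d = -(c * τ + u * star σ + star w * σ) := by linear_combination ht
    rw [this]; simp [Complex.normSq_apply]; ring
  have he0 : 0 ≤ e' := by
    have := hQ1 σ τ
    linarith
  have hD := (canon_decomp u w a c e' ha0 hc0 he0 hac).conj !![1, -σ; 0, 1] !![1, -τ; 0, 1]
  have hbe : b = -(a * σ + u * star τ + w * τ) := by linear_combination hs
  have hde : d = -(c * τ + u * star σ + star w * σ) := by linear_combination ht
  convert hD using 1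
  have y00 : ∀ p, Y p (0,0) = star (Y (0,0) p) := fun p => hh _ _
  have y01 : Y (1,0) (0,1) = star w := hh _ _
  have y02 : Y (1,1) (0,1) = star b := hh _ _
  have y03 : Y (1,1) (1,0) = star d := hh _ _
  have ya : Y (0,1) (0,1) = a := (hd _).symm
  have yc : Y (1,0) (1,0) = c := (hd _).symm
  have ye : Y (1,1) (1,1) = e := (hd _).symm
  have ee : (e : ℂ) = e' + a * (star σ * σ) + c * (star τ * τ)
      + star u * (σ * τ) + u * star (σ * τ) + w * (star σ * τ) + star w * (σ * star τ) := by
    have : e = e' - (star b * σ).re - (star d * τ).re := by rw [he']; ring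
    rw [this, hbσ, hdτ]
    apply Complex.ext <;> simp [Complex.normSq_apply] <;> ring
  have y1b : Y (0,1) (1,1) = -(a * σ + u * star τ + w * τ) := hbe
  have y1d : Y (1,0) (1,1) = -(c * τ + u * star σ + star w * σ) := hde
  refine shear_eq Y u w σ τ a c e' h0 h1 h2 hu.symm ?_ ya hw.symm y1b ?_ y01 yc y1d ?_ ?_ ?_
    (ye.trans ee)
  · rw [y00, h1, star_zero]
  · rw [y00, h2, star_zero]
  · rw [y00]
  · rw [y02, hbe]
  · rw [y03, hde]

lemma bq_smul (Y : Mat 2 2) (r s : ℝ) (x y : Fin 2 → ℂ) :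
    (bq Y (fun i => r * x i) (fun i => s * y i)).re = (r ^ 2 * s ^ 2) * (bq Y x y).re := by
  have : bq Y (fun i => r * x i) (fun i => s * y i) = ((r ^ 2 * s ^ 2 : ℝ) : ℂ) * bq Y x y := by
    simp [bq, pv, dotProduct, Matrix.mulVec, Fintype.sum_prod_type, Fin.sum_univ_two]
    ring
  rw [this, Complex.re_ofReal_mul]

lemma normalize_vec (x : Fin 2 → ℂ) : x = 0 ∨ ∃ (r : ℝ) (z : Fin 2 → ℂ),
    Complex.normSq (z 0) + Complex.normSq (z 1) = 1 ∧ x = (fun i => r * z i) ∧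
    Complex.normSq (x 0) + Complex.normSq (x 1) = r ^ 2 := by
  have hn0 := Complex.normSq_nonneg (x 0)
  have hn1 := Complex.normSq_nonneg (x 1)
  rcases (add_nonneg hn0 hn1).eq_or_lt with h | h
  · left
    ext i
    have h0 : x 0 = 0 := Complex.normSq_eq_zero.1 (by linarith)
    have h1 : x 1 = 0 := Complex.normSq_eq_zero.1 (by linarith)
    fin_cases i <;> simp [h0, h1]
  · right
    set n := Complex.normSq (x 0) + Complex.normSq (x 1) with hn
    have hr : √n ≠ 0 := (Real.sqrt_pos.2 h).ne'
    have hr' : ((√n : ℝ) : ℂ) ≠ 0 := by exact_mod_cast hr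
    have hsq : √n ^ 2 = n := Real.sq_sqrt h.le
    refine ⟨√n, fun i => ((√n)⁻¹ : ℝ) * x i, ?_, ?_, hsq.symm⟩
    · simp only [map_mul, Complex.normSq_ofReal]
      rw [← mul_add, ← hn]
      nth_rewrite 3 [← hsq]
      field_simp
    · ext i
      push_cast
      field_simp

lemma exists_min (Y : Mat 2 2) : ∃ x0 x1 y0 y1 : ℂ,
    Complex.normSq x0 + Complex.normSq x1 = 1 ∧ Complex.normSq y0 + Complex.normSq y1 = 1 ∧
    ∀ x y : Fin 2 → ℂ, (bq Y ![x0, x1] ![y0, y1]).re *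
      ((Complex.normSq (x 0) + Complex.normSq (x 1)) *
        (Complex.normSq (y 0) + Complex.normSq (y 1))) ≤ (bq Y x y).re := by
  let K : Set ((Fin 2 → ℂ) × (Fin 2 → ℂ)) :=
    {p | Complex.normSq (p.1 0) + Complex.normSq (p.1 1) = 1 ∧
      Complex.normSq (p.2 0) + Complex.normSq (p.2 1) = 1}
  have hKc : IsClosed K := by
    apply IsClosed.inter
    · exact isClosed_eq (by
        have := Complex.continuous_normSq
        fun_prop) continuous_const
    · exact isClosed_eq (by
        have := Complex.continuous_normSq
        fun_prop) continuous_const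
  have aux : ∀ x : Fin 2 → ℂ, Complex.normSq (x 0) + Complex.normSq (x 1) = 1 → ‖x‖ ≤ 1 := by
    intro x hx
    rw [pi_norm_le_iff_of_nonneg zero_le_one]
    rw [Complex.normSq_eq_norm_sq, Complex.normSq_eq_norm_sq] at hx
    intro i
    fin_cases i
    · simp only [Fin.zero_eta]
      nlinarith [norm_nonneg (x 0), sq_nonneg ‖x 1‖]
    · simp only [Fin.mk_one]
      nlinarith [norm_nonneg (x 1), sq_nonneg ‖x 0‖]
  have hK : IsCompact K := by
    apply Metric.isCompact_of_isClosed_isBounded hKc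
    apply (Metric.isBounded_closedBall (x := (0 : (Fin 2 → ℂ) × (Fin 2 → ℂ))) (r := 1)).subset
    rintro ⟨x, y⟩ ⟨hx, hy⟩
    rw [mem_closedBall_zero_iff, Prod.norm_def]
    exact max_le (aux x hx) (aux y hy)
  have hcont : Continuous fun p : (Fin 2 → ℂ) × (Fin 2 → ℂ) => (bq Y p.1 p.2).re := by
    simp only [bq, pv, dotProduct, Matrix.mulVec, Pi.star_apply]
    fun_prop
  obtain ⟨⟨x, y⟩, ⟨hx, hy⟩, hmin⟩ := hK.exists_isMinOn
    ⟨(![1, 0], ![1, 0]), by simp [K]⟩ hcont.continuousOn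
  have hxe : ![x 0, x 1] = x := by ext i; fin_cases i <;> rfl
  have hye : ![y 0, y 1] = y := by ext i; fin_cases i <;> rfl
  refine ⟨x 0, x 1, y 0, y 1, hx, hy, ?_⟩
  intro x' y'
  rw [hxe, hye]
  rcases normalize_vec x' with h | ⟨r, z, hz, hxz, hr⟩
  · subst h; simp [bq, pv, dotProduct]
  rcases normalize_vec y' with h | ⟨s, z', hz', hyz, hs⟩
  · subst h; simp [bq, pv, dotProduct]
  rw [hr, hs, hxz, hyz, bq_smul, mul_comm]
  have := hmin (show (z, z') ∈ K from ⟨hz, hz'⟩)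
  exact mul_le_mul_of_nonneg_left this (by positivity)

lemma unitary_aux (x0 x1 : ℂ) (h : Complex.normSq x0 + Complex.normSq x1 = 1) :
    !![x0, -star x1; x1, star x0] * (!![x0, -star x1; x1, star x0])ᴴ = 1 := by
  have h' : star x0 * x0 + star x1 * x1 = 1 := by
    have h0 := Complex.normSq_eq_conj_mul_self (z := x0)
    have h1 := Complex.normSq_eq_conj_mul_self (z := x1)
    have h2 : ((Complex.normSq x0 + Complex.normSq x1 : ℝ) : ℂ) = 1 := by rw [h]; simp
    push_cast at h2
    rw [h0, h1] at h2
    exact h2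
  ext i j
  fin_cases i <;> fin_cases j <;> simp [Matrix.mul_apply, Fin.sum_univ_two] at h' ⊢
  · linear_combination h'
  · ring
  · ring
  · linear_combination h'

lemma decomp_of_nonneg (Y : Mat 2 2) (hY : Y.IsHermitian) (h : ∀ x y, 0 ≤ (bq Y x y).re) :
    Decomp Y := by
  obtain ⟨x0, x1, y0, y1, hx, hy, hmin⟩ := exists_min Y
  set m : ℝ := (bq Y ![x0, x1] ![y0, y1]).re with hm
  have hm0 : 0 ≤ m := h _ _
  set P : Matrix (Fin 2) (Fin 2) ℂ := !![x0, -star x1; x1, star x0] with hP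
  set R : Matrix (Fin 2) (Fin 2) ℂ := !![y0, -star y1; y1, star y0] with hR
  have hPu : P * Pᴴ = 1 := unitary_aux x0 x1 hx
  have hRu : R * Rᴴ = 1 := unitary_aux y0 y1 hy
  have hU : (P ⊗ₖ R) * (P ⊗ₖ R)ᴴ = 1 := by
    rw [conjTranspose_kronecker, ← mul_kronecker_mul, hPu, hRu, one_kronecker_one]
  set Z : Mat 2 2 := Y - (m : ℂ) • 1 with hZ
  have h1 : ((m : ℂ) • (1 : Mat 2 2)).PosSemidef :=
    Matrix.PosSemidef.one.smul (Complex.zero_le_real.2 hm0)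
  have hZh : Z.IsHermitian := hY.sub h1.1
  have hbq : ∀ x y, (bq Z x y).re = (bq Y x y).re - m *
      ((Complex.normSq (x 0) + Complex.normSq (x 1)) *
        (Complex.normSq (y 0) + Complex.normSq (y 1))) := by
    intro x y
    have : bq Z x y = bq Y x y - m * (star (pv x y) ⬝ᵥ pv x y) := by
      rw [bq, bq, hZ, Matrix.sub_mulVec, dotProduct_sub, Matrix.smul_mulVec, Matrix.one_mulVec,
        dotProduct_smul, smul_eq_mul]
    rw [this, Complex.sub_re, Complex.re_ofReal_mul]
    congr 2
    simp [pv, dotProduct, Fintype.sum_prod_type, Fin.sum_univ_two, Complex.normSq_apply]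
    ring
  have hZn : ∀ x y, 0 ≤ (bq Z x y).re := by
    intro x y
    rw [hbq]
    linarith [hmin x y]
  set W : Mat 2 2 := (P ⊗ₖ R)ᴴ * Z * (P ⊗ₖ R) with hW
  have hWh : W.IsHermitian := isHermitian_conjTranspose_mul_mul _ hZh
  have hW0 : W (0,0) (0,0) = 0 := by
    have e1 : W (0,0) (0,0) = bq W ![1, 0] ![1, 0] := by
      simp [bq, pv, dotProduct, Matrix.mulVec, Fintype.sum_prod_type, Fin.sum_univ_two]
    have e2 : P *ᵥ ![1, 0] = ![x0, x1] := by
      ext i; fin_cases i <;> simp [hP]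
    have e3 : R *ᵥ ![1, 0] = ![y0, y1] := by
      ext i; fin_cases i <;> simp [hR]
    apply Complex.ext
    · rw [e1, hW, bq_conj, e2, e3, hbq]
      simp [hx, hy, hm]
    · have := congrArg Complex.im (hWh.apply (0,0) (0,0))
      simp at this ⊢
      linarith
  have hWn : ∀ x y, 0 ≤ (bq W x y).re := by
    intro x y
    rw [hW, bq_conj]
    exact hZn _ _
  have hD := (core_s4 W hWh hWn hW0).conj Pᴴ Rᴴ
  have e : (Pᴴ ⊗ₖ Rᴴ)ᴴ * W * (Pᴴ ⊗ₖ Rᴴ) = Z := by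
    rw [← conjTranspose_kronecker, conjTranspose_conjTranspose, hW]
    calc (P ⊗ₖ R) * ((P ⊗ₖ R)ᴴ * Z * (P ⊗ₖ R)) * (P ⊗ₖ R)ᴴ
        = ((P ⊗ₖ R) * (P ⊗ₖ R)ᴴ) * Z * ((P ⊗ₖ R) * (P ⊗ₖ R)ᴴ) := by
          simp only [Matrix.mul_assoc]
      _ = Z := by rw [hU, Matrix.one_mul, Matrix.mul_one]
  rw [e] at hD
  obtain ⟨T, T', hT, hT', hTT⟩ := hD
  refine ⟨T + (m : ℂ) • 1, T', hT.add h1, hT', ?_⟩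
  rw [add_right_comm, ← hTT, hZ, sub_add_cancel]

lemma trace_mul_nonneg {X T : Mat 2 2} (hX : X.PosSemidef) (hT : T.PosSemidef) :
    0 ≤ (X * T).trace := by
  obtain ⟨B, rfl⟩ : ∃ B : Mat 2 2, X = Bᴴ * B := by
    open scoped MatrixOrder in
    exact CStarAlgebra.nonneg_iff_eq_star_mul_self.1 hX.nonneg
  rw [Matrix.mul_assoc, Matrix.trace_mul_comm, Matrix.mul_assoc, ← Matrix.mul_assoc]
  exact (hT.mul_mul_conjTranspose_same B).trace_nonneg

lemma trace_ptB (A B : Matrix (Fin 2) (Fin 2) ℂ) (T : Mat 2 2) :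
    ((A ⊗ₖ B) * ptB T).trace = ((A ⊗ₖ Bᵀ) * T).trace := by
  simp [ptB, Matrix.trace, Matrix.mul_apply, Fintype.sum_prod_type, Fin.sum_univ_two]
  ring

/-- Characterization of the dual cone SEP* in the (2,2)-dimensional case:
`Y ∈ SEP*` iff `Y = T + Γ(T')` with `T, T'` positive semidefinite. -/
theorem dual_cone_characterization (Y : Mat 2 2) (hY : Y.IsHermitian) :
    InSEPDual Y ↔
      ∃ T T' : Mat 2 2, T.PosSemidef ∧ T'.PosSemidef ∧ Y = T + ptB T' := by
  constructor
  · intro h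
    exact decomp_of_nonneg Y hY fun x y => (Complex.le_def.1 (bq_nonneg h x y)).1
  · rintro ⟨T, T', hT, hT', rfl⟩
    refine ⟨hY, fun A B hA hB => ?_⟩
    rw [Matrix.mul_add, Matrix.trace_add, trace_ptB]
    exact add_nonneg (trace_mul_nonneg (hA.kronecker hB) hT)
      (trace_mul_nonneg (hA.kronecker hB.transpose) hT')
end
end

section
/- Let p1, p2, α1, α2 ∈ [0,1] and β2 ≥ 0 with β2² ≤ α2(1−α2), and define the product states ρ1 = [[1−p1,0],[0,p1]] ⊗ [[1−p2,0],[0,p2]] and ρ2 = [[1−α1, 0],[0, α1]] ⊗ [[1−α2, β2],[β2, α2]] on ℂ² ⊗ ℂ² (the A-factors of both states are diagonal, i.e. β1 = 0). If ρ1 and ρ2 are perfectly distinguishable in SEP, then Tr(ρ1 ρ2) = 0, i.e. ρ1 and ρ2 are orthogonal. -/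
open Matrix Kronecker ComplexOrder

noncomputable section

open scoped MatrixOrder Matrix.Norms.L2Operator in
theorem aux_fac {P : Matrix (Fin 2) (Fin 2) ℂ} (hP : P.PosSemidef) :
    ∃ C : Matrix (Fin 2) (Fin 2) ℂ, P = Cᴴ * C :=
  CStarAlgebra.nonneg_iff_eq_star_mul_self.mp hP.nonneg

theorem aux_mul_zero {N P : Matrix (Fin 2) (Fin 2) ℂ} (hN : N.PosSemidef) (hP : P.PosSemidef)
    (h : (P * N).trace = 0) : P * N = 0 := by
  obtain ⟨C, rfl⟩ := aux_fac hP
  obtain ⟨D, rfl⟩ := aux_fac hN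
  have h1 : ((C * Dᴴ)ᴴ * (C * Dᴴ)).trace = 0 := by
    rw [← h, conjTranspose_mul, conjTranspose_conjTranspose, Matrix.trace_mul_comm (Cᴴ * C)]
    rw [Matrix.mul_assoc Dᴴ, Matrix.trace_mul_comm Dᴴ]
    simp only [Matrix.mul_assoc]
  have h2 : C * Dᴴ = 0 := Matrix.trace_conjTranspose_mul_self_eq_zero_iff.1 h1
  calc Cᴴ * C * (Dᴴ * D) = Cᴴ * (C * Dᴴ) * D := by simp only [Matrix.mul_assoc]
    _ = 0 := by rw [h2]; simp

theorem aux_orth {N N' P Q : Matrix (Fin 2) (Fin 2) ℂ} (hN : N.PosSemidef) (hN' : N'.PosSemidef)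
    (hs : N + N' = 1) (hP : P.PosSemidef) (hQ : Q.PosSemidef)
    (h1 : (P * N').trace = 0) (h2 : (Q * N).trace = 0) : (P * Q).trace = 0 := by
  have e1 := aux_mul_zero hN' hP h1
  have e2 := aux_mul_zero hN hQ h2
  have : P * Q = P * N' * Q + P * (Q * N)ᴴ := by
    rw [conjTranspose_mul, hN.1.eq, hQ.1.eq, Matrix.mul_assoc, ← Matrix.mul_add, ← Matrix.add_mul,
      add_comm, hs, Matrix.one_mul]
  rw [this, e1, e2]; simp

theorem aux_real (α β a b : ℝ) (h0 : 0 ≤ α) (h1 : α ≤ 1) (hb : β ^ 2 ≤ α * (1 - α)) :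
    0 ≤ (1 - α) * a ^ 2 + 2 * β * a * b + α * b ^ 2 := by
  rcases h0.eq_or_lt with h | h
  · subst h
    have : β = 0 := by nlinarith [sq_nonneg β]
    subst this; nlinarith [sq_nonneg a]
  · have : 0 ≤ α * ((1 - α) * a ^ 2 + 2 * β * a * b + α * b ^ 2) := by
      nlinarith [sq_nonneg (β * a + α * b), mul_nonneg (sub_nonneg.2 hb) (sq_nonneg a)]
    exact nonneg_of_mul_nonneg_right this h

theorem aux_psd (α β : ℝ) (h0 : 0 ≤ α) (h1 : α ≤ 1) (hb : β ^ 2 ≤ α * (1 - α)) :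
    (!![((1 - α : ℝ) : ℂ), (β : ℝ); (β : ℝ), (α : ℝ)] : Matrix (Fin 2) (Fin 2) ℂ).PosSemidef := by
  refine PosSemidef.of_dotProduct_mulVec_nonneg ?_ ?_
  · ext i j
    fin_cases i <;> fin_cases j <;> simp [Matrix.conjTranspose_apply]
  · intro x
    have e1 := aux_real α β (x 0).re (x 1).re h0 h1 hb
    have e2 := aux_real α β (x 0).im (x 1).im h0 h1 hb
    rw [Complex.le_def]
    simp [dotProduct, Matrix.mulVec, Fin.sum_univ_two]
    constructor
    · nlinarith
    · ring

theorem aux_block {M : Mat 2 2} (hM : InSEPDual M) (i : Fin 2) :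
    (M.submatrix (fun k => (i, k)) (fun k => (i, k))).PosSemidef := by
  refine PosSemidef.of_dotProduct_mulVec_nonneg (hM.1.submatrix _) ?_
  intro x
  have := hM.2 (vecMulVec (Pi.single i 1) (star (Pi.single i 1))) (vecMulVec x (star x))
    (posSemidef_vecMulVec_self_star _) (posSemidef_vecMulVec_self_star _)
  convert this using 1
  fin_cases i <;>
  simp [Matrix.trace, Matrix.mul_apply, Fintype.sum_prod_type, Fin.sum_univ_two, dotProduct,
    Matrix.mulVec, vecMulVec_apply] <;> ring

theorem aux_tr (M : Mat 2 2) (a b : ℂ) (B : Matrix (Fin 2) (Fin 2) ℂ) :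
    (M * (!![a, 0; 0, b] ⊗ₖ B)).trace =
      a * (B * M.submatrix (fun k => ((0 : Fin 2), k)) (fun k => ((0 : Fin 2), k))).trace +
      b * (B * M.submatrix (fun k => ((1 : Fin 2), k)) (fun k => ((1 : Fin 2), k))).trace := by
  simp [Matrix.trace, Matrix.mul_apply, Fintype.sum_prod_type, Fin.sum_univ_two]
  ring

theorem aux_trnn {N P : Matrix (Fin 2) (Fin 2) ℂ} (hN : N.PosSemidef) (hP : P.PosSemidef) :
    0 ≤ (P * N).trace := by
  obtain ⟨C, rfl⟩ := aux_fac hP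
  rw [Matrix.mul_assoc, Matrix.trace_mul_comm]
  exact (hN.mul_mul_conjTranspose_same C).trace_nonneg

theorem aux_split {a b : ℝ} {x y : ℂ} (ha : 0 ≤ a) (hb : 0 ≤ b) (hx : 0 ≤ x) (hy : 0 ≤ y)
    (h : (a : ℂ) * x + (b : ℂ) * y = 0) : (a = 0 ∨ x = 0) ∧ (b = 0 ∨ y = 0) := by
  have ha' : (0 : ℂ) ≤ a := by exact_mod_cast ha
  have hb' : (0 : ℂ) ≤ b := by exact_mod_cast hb
  have := (add_eq_zero_iff_of_nonneg (mul_nonneg ha' hx) (mul_nonneg hb' hy)).1 h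
  simpa using this

/-- If the `A`-factors of both product states are diagonal (`β1 = 0`), then perfect
distinguishability in SEP forces the two states to be orthogonal. -/
theorem diagonal_case_orthogonal (p1 p2 α1 α2 β2 : ℝ)
    (hp1 : p1 ∈ Set.Icc (0:ℝ) 1) (hp2 : p2 ∈ Set.Icc (0:ℝ) 1)
    (hα1 : α1 ∈ Set.Icc (0:ℝ) 1) (hα2 : α2 ∈ Set.Icc (0:ℝ) 1)
    (hβ2 : 0 ≤ β2) (hβ2' : β2 ^ 2 ≤ α2 * (1 - α2))
    (ρ1 ρ2 : Mat 2 2)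
    (hρ1 : ρ1 = (!![((1 - p1 : ℝ) : ℂ), 0; 0, (p1 : ℝ)]) ⊗ₖ
      (!![((1 - p2 : ℝ) : ℂ), 0; 0, (p2 : ℝ)]))
    (hρ2 : ρ2 = (!![((1 - α1 : ℝ) : ℂ), 0; 0, (α1 : ℝ)]) ⊗ₖ
      (!![((1 - α2 : ℝ) : ℂ), (β2 : ℝ); (β2 : ℝ), (α2 : ℝ)]))
    (h : PerfDistSEP ρ1 ρ2) :
    (ρ1 * ρ2).trace = 0 := by
  obtain ⟨M1, M2, hM1, hM2, hs, -, -, h1, h2⟩ := h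
  have hP : (!![((1 - p2 : ℝ) : ℂ), 0; 0, (p2 : ℝ)]).PosSemidef := by
    simpa using aux_psd p2 0 hp2.1 hp2.2 (by nlinarith [hp2.1, hp2.2])
  have hQ := aux_psd α2 β2 hα2.1 hα2.2 hβ2'
  have hsum : ∀ i : Fin 2, M1.submatrix (fun k => (i, k)) (fun k => (i, k)) +
      M2.submatrix (fun k => (i, k)) (fun k => (i, k)) = 1 := by
    intro i
    change (M1 + M2).submatrix (fun k => (i, k)) (fun k => (i, k)) = 1
    rw [hs]
    exact Matrix.submatrix_one _ (fun a b hab => by simpa using hab)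
  have key : ∀ i : Fin 2, _ := fun i => aux_orth (aux_block hM1 i) (aux_block hM2 i) (hsum i) hP hQ
  rw [hρ1, aux_tr] at h1
  rw [hρ2, aux_tr] at h2
  obtain ⟨u0, u1⟩ := aux_split (sub_nonneg.2 hp1.2) hp1.1 (aux_trnn (aux_block hM2 0) hP)
    (aux_trnn (aux_block hM2 1) hP) h1
  obtain ⟨v0, v1⟩ := aux_split (sub_nonneg.2 hα1.2) hα1.1 (aux_trnn (aux_block hM1 0) hQ)
    (aux_trnn (aux_block hM1 1) hQ) h2
  rw [hρ1, hρ2, ← Matrix.mul_kronecker_mul, Matrix.trace_kronecker]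
  by_cases hPQ : (!![((1 - p2 : ℝ) : ℂ), 0; 0, (p2 : ℝ)] *
      !![((1 - α2 : ℝ) : ℂ), (β2 : ℝ); (β2 : ℝ), (α2 : ℝ)]).trace = 0
  · rw [hPQ, mul_zero]
  have w0 : (1 - p1) * (1 - α1) = 0 := by
    rcases u0 with u | u
    · rw [u, zero_mul]
    rcases v0 with v | v
    · rw [v, mul_zero]
    exact absurd (key 0 u v) hPQ
  have w1 : p1 * α1 = 0 := by
    rcases u1 with u | u
    · rw [u, zero_mul]
    rcases v1 with v | v
    · rw [v, mul_zero]
    exact absurd (key 1 u v) hPQ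
  have : (!![((1 - p1 : ℝ) : ℂ), 0; 0, (p1 : ℝ)] *
      !![((1 - α1 : ℝ) : ℂ), 0; 0, (α1 : ℝ)]).trace = 0 := by
    have : (!![((1 - p1 : ℝ) : ℂ), 0; 0, (p1 : ℝ)] *
      !![((1 - α1 : ℝ) : ℂ), 0; 0, (α1 : ℝ)]).trace =
      (((1 - p1) * (1 - α1) : ℝ) : ℂ) + ((p1 * α1 : ℝ) : ℂ) := by
      simp [Matrix.trace, Fin.sum_univ_two]
    rw [this, w0, w1]; simp
  rw [this, zero_mul]
end
end
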